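/- arXiv:1310.8323 — 2 statements merged into one kernel-verified Lean document; each statement's English description precedes it below -/
import Mathlib

section
/- Let (H, μ, Δ) be a bialgebra (associative multiplication, coassociative comultiplication Δ which is multiplicative, i.e. Δ(hh')=h₁h'₁⊗h₂h'₂; no unit or counit assumed) over a field k, and let α_H: H→H be a bialgebra endomorphism (an algebra and coalgebra map). Let M be a classical Yetter-Drinfeld module over H, i.e. a left H-module and left H-comodule (coaction m ↦ m_{(-1)}⊗m_{(0)}) with (h₁·m)_{(-1)}h₂ ⊗ (h₁·m)_{(0)} = h₁m_{(-1)} ⊗ h₂·m_{(0)} for all h∈H, m∈M. Let α_M: M→M be a linear map with α_M(h·m)=α_H(h)·α_M(m) and with coaction of α_M(m) equal to α_H(m_{(-1)})⊗α_M(m_{(0)}). Then M, equipped with the structure map α_M, the twisted action h▷m := α_H(h)·α_M(m) and the twisted coaction m ↦ α_H(m_{(-1)})⊗α_M(m_{(0)}), is a Yetter-Drinfeld module over the Hom-bialgebra H_{α_H} = (H, α_H∘μ, Δ∘α_H, α_H); in particular, writing h*h' = α_H(hh') and h_{(1)}⊗h_{(2)} = α_H(h₁)⊗α_H(h₂), the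 Hom-Yetter-Drinfeld compatibility (h_{(1)}▷m)_{<-1>} * α_H²(h_{(2)}) ⊗ (h_{(1)}▷m)_{<0>} = α_H²(h_{(1)}) * α_H(m_{<-1>}) ⊗ α_H(h_{(2)})▷m_{<0>} holds, where m_{<-1>}⊗m_{<0>} = α_H(m_{(-1)})⊗α_M(m_{(0)}). -/
open TensorProduct

noncomputable section

namespace HomYD

variable (k : Type*) [Field k]
variable {H M N : Type*}
variable [AddCommGroup H] [Module k H]
variable [AddCommGroup M] [Module k M]
variable [AddCommGroup N] [Module k N]

/-- Rearrangement `(a ⊗ b) ⊗ c ↦ (a ⊗ c) ⊗ b`. -/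
def rearr (A B C : Type*) [AddCommGroup A] [Module k A] [AddCommGroup B] [Module k B]
    [AddCommGroup C] [Module k C] :
    (A ⊗[k] B) ⊗[k] C →ₗ[k] (A ⊗[k] C) ⊗[k] B :=
  (TensorProduct.assoc k A C B).symm.toLinearMap ∘ₗ
    (TensorProduct.map LinearMap.id (TensorProduct.comm k B C).toLinearMap) ∘ₗ
      (TensorProduct.assoc k A B C).toLinearMap

/-- Middle-four exchange `(a ⊗ b) ⊗ (c ⊗ d) ↦ (a ⊗ c) ⊗ (b ⊗ d)`. -/
def ttc (A B C D : Type*) [AddCommGroup A] [Module k A] [AddCommGroup B] [Module k B]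
    [AddCommGroup C] [Module k C] [AddCommGroup D] [Module k D] :
    (A ⊗[k] B) ⊗[k] (C ⊗[k] D) →ₗ[k] (A ⊗[k] C) ⊗[k] (B ⊗[k] D) :=
  (TensorProduct.tensorTensorTensorComm k A B C D).toLinearMap

/-- Hom-bialgebra (no unit/counit): multiplicativity of `α`, Hom-associativity,
comultiplicativity of `α`, Hom-coassociativity, and `Δ` multiplicative. -/
structure IsHomBialgebra (μ : H ⊗[k] H →ₗ[k] H) (Δ : H →ₗ[k] H ⊗[k] H)
    (α : H →ₗ[k] H) : Prop where
  mul_mult : ∀ a b : H, α (μ (a ⊗ₜ[k] b)) = μ (α a ⊗ₜ[k] α b)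
  hom_assoc : ∀ a b c : H, μ (α a ⊗ₜ[k] μ (b ⊗ₜ[k] c)) = μ (μ (a ⊗ₜ[k] b) ⊗ₜ[k] α c)
  comul_compat : TensorProduct.map α α ∘ₗ Δ = Δ ∘ₗ α
  hom_coassoc : (TensorProduct.assoc k H H H).toLinearMap ∘ₗ TensorProduct.map Δ α ∘ₗ Δ
      = TensorProduct.map α Δ ∘ₗ Δ
  comul_mul : Δ ∘ₗ μ
      = TensorProduct.map μ μ ∘ₗ ttc k H H H H ∘ₗ TensorProduct.map Δ Δ

/-- Left module over a Hom-(bi)algebra. -/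
structure IsHomModule (μ : H ⊗[k] H →ₗ[k] H) (α : H →ₗ[k] H)
    (ρ : H ⊗[k] M →ₗ[k] M) (αM : M →ₗ[k] M) : Prop where
  str_compat : ∀ (h : H) (m : M), αM (ρ (h ⊗ₜ[k] m)) = ρ (α h ⊗ₜ[k] αM m)
  hom_smul : ∀ (h h' : H) (m : M),
      ρ (α h ⊗ₜ[k] ρ (h' ⊗ₜ[k] m)) = ρ (μ (h ⊗ₜ[k] h') ⊗ₜ[k] αM m)

/-- Left comodule over a Hom-(bi)algebra. -/
structure IsHomComodule (Δ : H →ₗ[k] H ⊗[k] H) (α : H →ₗ[k] H)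
    (lM : M →ₗ[k] H ⊗[k] M) (αM : M →ₗ[k] M) : Prop where
  str_compat : TensorProduct.map α αM ∘ₗ lM = lM ∘ₗ αM
  hom_coact : TensorProduct.map Δ αM ∘ₗ lM
      = (TensorProduct.assoc k H H M).symm.toLinearMap ∘ₗ TensorProduct.map α lM ∘ₗ lM

/-- `h ⊗ m ↦ (h₁·m)₍₋₁₎ β(h₂) ⊗ (h₁·m)₍₀₎`. -/
def ydL (μ : H ⊗[k] H →ₗ[k] H) (Δ : H →ₗ[k] H ⊗[k] H) (β : H →ₗ[k] H)
    (ρ : H ⊗[k] M →ₗ[k] M) (lM : M →ₗ[k] H ⊗[k] M) : H ⊗[k] M →ₗ[k] H ⊗[k] M :=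
  TensorProduct.map μ LinearMap.id ∘ₗ rearr k H M H ∘ₗ
    TensorProduct.map (lM ∘ₗ ρ) β ∘ₗ rearr k H H M ∘ₗ
      TensorProduct.map Δ LinearMap.id

/-- `h ⊗ m ↦ β(h₁) γ(m₍₋₁₎) ⊗ γ(h₂)·m₍₀₎`. -/
def ydR (μ : H ⊗[k] H →ₗ[k] H) (Δ : H →ₗ[k] H ⊗[k] H) (β γ : H →ₗ[k] H)
    (ρ : H ⊗[k] M →ₗ[k] M) (lM : M →ₗ[k] H ⊗[k] M) : H ⊗[k] M →ₗ[k] H ⊗[k] M :=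
  TensorProduct.map (μ ∘ₗ TensorProduct.map β γ) (ρ ∘ₗ TensorProduct.map γ LinearMap.id) ∘ₗ
    ttc k H H H M ∘ₗ TensorProduct.map Δ lM

/-- Yetter-Drinfeld module over a Hom-bialgebra: Hom-module, Hom-comodule and the
compatibility `(h₁·m)₍₋₁₎ α²(h₂) ⊗ (h₁·m)₍₀₎ = α²(h₁) α(m₍₋₁₎) ⊗ α(h₂)·m₍₀₎`. -/
def IsYetterDrinfeld (μ : H ⊗[k] H →ₗ[k] H) (Δ : H →ₗ[k] H ⊗[k] H) (α : H →ₗ[k] H)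
    (ρ : H ⊗[k] M →ₗ[k] M) (lM : M →ₗ[k] H ⊗[k] M) (αM : M →ₗ[k] M) : Prop :=
  IsHomModule k μ α ρ αM ∧ IsHomComodule k Δ α lM αM ∧
    ydL k μ Δ (α ∘ₗ α) ρ lM = ydR k μ Δ (α ∘ₗ α) α ρ lM

/-- `m ⊗ n ↦ αHinv(m₍₋₁₎)·n ⊗ m₍₀₎`. -/
def Bmap (αHinv : H →ₗ[k] H) (lM : M →ₗ[k] H ⊗[k] M) (ρN : H ⊗[k] N →ₗ[k] N) :
    M ⊗[k] N →ₗ[k] N ⊗[k] M :=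
  TensorProduct.map (ρN ∘ₗ TensorProduct.map αHinv LinearMap.id) LinearMap.id ∘ₗ
    rearr k H M N ∘ₗ TensorProduct.map lM LinearMap.id

/-- Quasi-braiding `m ⊗ n ↦ αN⁻¹(αH⁻¹(m₍₋₁₎)·n) ⊗ αM⁻¹(m₍₀₎)`. -/
def braidYD (αH : H ≃ₗ[k] H) (αM : M ≃ₗ[k] M) (αN : N ≃ₗ[k] N)
    (lM : M →ₗ[k] H ⊗[k] M) (ρN : H ⊗[k] N →ₗ[k] N) : M ⊗[k] N →ₗ[k] N ⊗[k] M :=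
  TensorProduct.map
      (αN.symm.toLinearMap ∘ₗ ρN ∘ₗ TensorProduct.map αH.symm.toLinearMap LinearMap.id)
      αM.symm.toLinearMap ∘ₗ rearr k H M N ∘ₗ TensorProduct.map lM LinearMap.id

/-- Action on `M ⊗ N`: `h ⊗ (m ⊗ n) ↦ h₁·m ⊗ h₂·n`. -/
def hatAction (Δ : H →ₗ[k] H ⊗[k] H)
    (ρM : H ⊗[k] M →ₗ[k] M) (ρN : H ⊗[k] N →ₗ[k] N) :
    H ⊗[k] (M ⊗[k] N) →ₗ[k] M ⊗[k] N :=
  TensorProduct.map ρM ρN ∘ₗ ttc k H H M N ∘ₗ TensorProduct.map Δ LinearMap.id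

/-- Coaction on `M ⊗ N`: `m ⊗ n ↦ αHinv²(m₍₋₁₎ n₍₋₁₎) ⊗ (m₍₀₎ ⊗ n₍₀₎)`. -/
def hatCoaction (μ : H ⊗[k] H →ₗ[k] H) (αHinv : H →ₗ[k] H)
    (lM : M →ₗ[k] H ⊗[k] M) (lN : N →ₗ[k] H ⊗[k] N) :
    M ⊗[k] N →ₗ[k] H ⊗[k] (M ⊗[k] N) :=
  TensorProduct.map (αHinv ∘ₗ αHinv ∘ₗ μ) LinearMap.id ∘ₗ ttc k H M H N ∘ₗ
    TensorProduct.map lM lN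

/-- Action on `M ⊗ N`: `h ⊗ (m ⊗ n) ↦ αHinv²(h₁)·m ⊗ αHinv²(h₂)·n`. -/
def tildeAction (Δ : H →ₗ[k] H ⊗[k] H) (αHinv : H →ₗ[k] H)
    (ρM : H ⊗[k] M →ₗ[k] M) (ρN : H ⊗[k] N →ₗ[k] N) :
    H ⊗[k] (M ⊗[k] N) →ₗ[k] M ⊗[k] N :=
  TensorProduct.map ρM ρN ∘ₗ ttc k H H M N ∘ₗ
    TensorProduct.map
      (TensorProduct.map (αHinv ∘ₗ αHinv) (αHinv ∘ₗ αHinv) ∘ₗ Δ) LinearMap.id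

/-- Coaction on `M ⊗ N`: `m ⊗ n ↦ m₍₋₁₎ n₍₋₁₎ ⊗ (m₍₀₎ ⊗ n₍₀₎)`. -/
def tildeCoaction (μ : H ⊗[k] H →ₗ[k] H)
    (lM : M →ₗ[k] H ⊗[k] M) (lN : N →ₗ[k] H ⊗[k] N) :
    M ⊗[k] N →ₗ[k] H ⊗[k] (M ⊗[k] N) :=
  TensorProduct.map μ LinearMap.id ∘ₗ ttc k H M H N ∘ₗ TensorProduct.map lM lN

/-- Associator `(x ⊗ y) ⊗ z ↦ αX⁻¹(x) ⊗ (y ⊗ αZ(z))`. -/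
def aYD {X Z : Type*} [AddCommGroup X] [Module k X] [AddCommGroup Z] [Module k Z]
    (αX : X ≃ₗ[k] X) (Y : Type*) [AddCommGroup Y] [Module k Y] (αZ : Z ≃ₗ[k] Z) :
    (X ⊗[k] Y) ⊗[k] Z →ₗ[k] X ⊗[k] (Y ⊗[k] Z) :=
  (TensorProduct.assoc k X Y Z).toLinearMap ∘ₗ
    TensorProduct.map (TensorProduct.map αX.symm.toLinearMap LinearMap.id) αZ.toLinearMap

/-- Inverse associator `x ⊗ (y ⊗ z) ↦ (αX(x) ⊗ y) ⊗ αZ⁻¹(z)`. -/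
def aYDinv {X Z : Type*} [AddCommGroup X] [Module k X] [AddCommGroup Z] [Module k Z]
    (αX : X ≃ₗ[k] X) (Y : Type*) [AddCommGroup Y] [Module k Y] (αZ : Z ≃ₗ[k] Z) :
    X ⊗[k] (Y ⊗[k] Z) →ₗ[k] (X ⊗[k] Y) ⊗[k] Z :=
  TensorProduct.map (TensorProduct.map αX.toLinearMap LinearMap.id) αZ.symm.toLinearMap ∘ₗ
    (TensorProduct.assoc k X Y Z).symm.toLinearMap

/-- Associator `(x ⊗ y) ⊗ z ↦ αX(x) ⊗ (y ⊗ αZ⁻¹(z))`. -/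
def aTilde {X Z : Type*} [AddCommGroup X] [Module k X] [AddCommGroup Z] [Module k Z]
    (αX : X ≃ₗ[k] X) (Y : Type*) [AddCommGroup Y] [Module k Y] (αZ : Z ≃ₗ[k] Z) :
    (X ⊗[k] Y) ⊗[k] Z →ₗ[k] X ⊗[k] (Y ⊗[k] Z) :=
  (TensorProduct.assoc k X Y Z).toLinearMap ∘ₗ
    TensorProduct.map (TensorProduct.map αX.toLinearMap LinearMap.id) αZ.symm.toLinearMap

/-- Inverse associator `x ⊗ (y ⊗ z) ↦ (αX⁻¹(x) ⊗ y) ⊗ αZ(z)`. -/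
def aTildeInv {X Z : Type*} [AddCommGroup X] [Module k X] [AddCommGroup Z] [Module k Z]
    (αX : X ≃ₗ[k] X) (Y : Type*) [AddCommGroup Y] [Module k Y] (αZ : Z ≃ₗ[k] Z) :
    X ⊗[k] (Y ⊗[k] Z) →ₗ[k] (X ⊗[k] Y) ⊗[k] Z :=
  TensorProduct.map (TensorProduct.map αX.symm.toLinearMap LinearMap.id) αZ.toLinearMap ∘ₗ
    (TensorProduct.assoc k X Y Z).symm.toLinearMap

/-- Quasitriangular Hom-bialgebra. -/
def IsQuasitriangular (μ : H ⊗[k] H →ₗ[k] H) (Δ : H →ₗ[k] H ⊗[k] H) (α : H →ₗ[k] H)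
    (R : H ⊗[k] H) : Prop :=
  IsHomBialgebra k μ Δ α ∧
  TensorProduct.map Δ α R
    = TensorProduct.map (TensorProduct.map α α) μ (ttc k H H H H (R ⊗ₜ[k] R)) ∧
  TensorProduct.map α Δ R
    = TensorProduct.map μ (TensorProduct.map α α ∘ₗ (TensorProduct.comm k H H).toLinearMap)
        (ttc k H H H H (R ⊗ₜ[k] R)) ∧
  ∀ h : H, TensorProduct.map μ μ (ttc k H H H H ((TensorProduct.comm k H H (Δ h)) ⊗ₜ[k] R))
      = TensorProduct.map μ μ (ttc k H H H H (R ⊗ₜ[k] Δ h))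

/-- Coaction induced by an R-matrix: `m ↦ α(R²) ⊗ R¹·m`. -/
def coactionFromR (R : H ⊗[k] H) (α : H →ₗ[k] H) (ρM : H ⊗[k] M →ₗ[k] M) :
    M →ₗ[k] H ⊗[k] M :=
  (TensorProduct.comm k M H).toLinearMap ∘ₗ TensorProduct.map ρM α ∘ₗ rearr k H H M ∘ₗ
    TensorProduct.mk k (H ⊗[k] H) M R

/-- Quasi-braiding from an R-matrix: `m ⊗ n ↦ αN⁻¹(R²·n) ⊗ αM⁻¹(R¹·m)`. -/
def braidR (R : H ⊗[k] H) (ρM : H ⊗[k] M →ₗ[k] M) (ρN : H ⊗[k] N →ₗ[k] N)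
    (αM : M ≃ₗ[k] M) (αN : N ≃ₗ[k] N) : M ⊗[k] N →ₗ[k] N ⊗[k] M :=
  TensorProduct.map αN.symm.toLinearMap αM.symm.toLinearMap ∘ₗ
    (TensorProduct.comm k M N).toLinearMap ∘ₗ TensorProduct.map ρM ρN ∘ₗ
      ttc k H H M N ∘ₗ TensorProduct.mk k (H ⊗[k] H) (M ⊗[k] N) R

/-- Coquasitriangular Hom-bialgebra. -/
def IsCoquasitriangular (μ : H ⊗[k] H →ₗ[k] H) (Δ : H →ₗ[k] H ⊗[k] H) (α : H →ₗ[k] H)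
    (σ : H ⊗[k] H →ₗ[k] k) : Prop :=
  IsHomBialgebra k μ Δ α ∧
  (∀ x y z : H, σ (μ (x ⊗ₜ[k] y) ⊗ₜ[k] α z)
      = LinearMap.mul' k k
          (TensorProduct.map σ σ (ttc k H H H H ((α x ⊗ₜ[k] α y) ⊗ₜ[k] Δ z)))) ∧
  (∀ x y z : H, σ (α x ⊗ₜ[k] μ (y ⊗ₜ[k] z))
      = LinearMap.mul' k k
          (TensorProduct.map σ σ (ttc k H H H H (Δ x ⊗ₜ[k] (α z ⊗ₜ[k] α y))))) ∧
  (∀ x y : H,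
      (TensorProduct.rid k H)
        (TensorProduct.map (μ ∘ₗ (TensorProduct.comm k H H).toLinearMap) σ
          (ttc k H H H H (Δ x ⊗ₜ[k] Δ y)))
      = (TensorProduct.lid k H)
          (TensorProduct.map σ μ (ttc k H H H H (Δ x ⊗ₜ[k] Δ y))))

/-- Action induced by a coquasitriangular form: `h ⊗ m ↦ σ(m₍₋₁₎ ⊗ α(h)) • m₍₀₎`. -/
def actionFromSigma (σ : H ⊗[k] H →ₗ[k] k) (α : H →ₗ[k] H)
    (lM : M →ₗ[k] H ⊗[k] M) : H ⊗[k] M →ₗ[k] M :=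
  (TensorProduct.lid k M).toLinearMap ∘ₗ
    TensorProduct.map (σ ∘ₗ TensorProduct.map LinearMap.id α ∘ₗ
        (TensorProduct.comm k H H).toLinearMap) LinearMap.id ∘ₗ
      (TensorProduct.assoc k H H M).symm.toLinearMap ∘ₗ
        TensorProduct.map LinearMap.id lM

/-- Quasi-braiding from a coquasitriangular form:
`m ⊗ n ↦ σ(n₍₋₁₎ ⊗ m₍₋₁₎) • (αN⁻¹(n₍₀₎) ⊗ αM⁻¹(m₍₀₎))`. -/
def braidSigma (σ : H ⊗[k] H →ₗ[k] k)
    (lM : M →ₗ[k] H ⊗[k] M) (lN : N →ₗ[k] H ⊗[k] N)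
    (αM : M ≃ₗ[k] M) (αN : N ≃ₗ[k] N) : M ⊗[k] N →ₗ[k] N ⊗[k] M :=
  (TensorProduct.lid k (N ⊗[k] M)).toLinearMap ∘ₗ
    TensorProduct.map (σ ∘ₗ (TensorProduct.comm k H H).toLinearMap)
      (TensorProduct.map αN.symm.toLinearMap αM.symm.toLinearMap ∘ₗ
        (TensorProduct.comm k M N).toLinearMap) ∘ₗ
      ttc k H M H N ∘ₗ TensorProduct.map lM lN


@[simp] theorem rearr_tmul {A B C : Type*} [AddCommGroup A] [Module k A] [AddCommGroup B]
    [Module k B] [AddCommGroup C] [Module k C] (a : A) (b : B) (c : C) :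
    rearr k A B C ((a ⊗ₜ[k] b) ⊗ₜ[k] c) = (a ⊗ₜ[k] c) ⊗ₜ[k] b := by
  simp [rearr]

@[simp] theorem ttc_tmul {A B C D : Type*} [AddCommGroup A] [Module k A] [AddCommGroup B]
    [Module k B] [AddCommGroup C] [Module k C] [AddCommGroup D] [Module k D]
    (a : A) (b : B) (c : C) (d : D) :
    ttc k A B C D ((a ⊗ₜ[k] b) ⊗ₜ[k] (c ⊗ₜ[k] d)) = (a ⊗ₜ[k] c) ⊗ₜ[k] (b ⊗ₜ[k] d) := by
  simp [ttc]

section Twist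

variable {k}
variable {μ : H ⊗[k] H →ₗ[k] H} {Δ : H →ₗ[k] H ⊗[k] H} {αH : H →ₗ[k] H}
  {ρ : H ⊗[k] M →ₗ[k] M} {lM : M →ₗ[k] H ⊗[k] M} {αM : M →ₗ[k] M}

theorem IsHomModule.twist
    (hαmul : ∀ a b : H, αH (μ (a ⊗ₜ[k] b)) = μ (αH a ⊗ₜ[k] αH b))
    (hmod : ∀ (a b : H) (m : M), ρ (μ (a ⊗ₜ[k] b) ⊗ₜ[k] m) = ρ (a ⊗ₜ[k] ρ (b ⊗ₜ[k] m)))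
    (hαM : ∀ (h : H) (m : M), αM (ρ (h ⊗ₜ[k] m)) = ρ (αH h ⊗ₜ[k] αM m)) :
    IsHomModule k (αH ∘ₗ μ) αH (ρ ∘ₗ TensorProduct.map αH αM) αM where
  str_compat h m := by simp [hαM]
  hom_smul h h' m := by simp [hαM, hαmul, hmod]

theorem IsHomComodule.twist
    (hαcomul : TensorProduct.map αH αH ∘ₗ Δ = Δ ∘ₗ αH)
    (hcomod : TensorProduct.map Δ (LinearMap.id : M →ₗ[k] M) ∘ₗ lM
        = (TensorProduct.assoc k H H M).symm.toLinearMap ∘ₗ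
            TensorProduct.map (LinearMap.id : H →ₗ[k] H) lM ∘ₗ lM)
    (hαMco : ∀ m : M, lM (αM m) = TensorProduct.map αH αM (lM m)) :
    IsHomComodule k (Δ ∘ₗ αH) αH (TensorProduct.map αH αM ∘ₗ lM) αM where
  str_compat := by
    ext m
    simp [hαMco]
  hom_coact := by
    have hΔ (h : H) : Δ (αH h) = TensorProduct.map αH αH (Δ h) :=
      (LinearMap.congr_fun hαcomul h).symm
    set S := TensorProduct.map (TensorProduct.map (αH ∘ₗ αH) (αH ∘ₗ αH)) (αM ∘ₗ αM)
    have hl : TensorProduct.map (Δ ∘ₗ αH) αM ∘ₗ TensorProduct.map αH αM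
        = S ∘ₗ TensorProduct.map Δ LinearMap.id := by
      ext h m
      simp [S, hΔ, TensorProduct.map_map]
    have hr : TensorProduct.map αH (TensorProduct.map αH αM ∘ₗ lM) ∘ₗ TensorProduct.map αH αM
        = TensorProduct.map (αH ∘ₗ αH) (TensorProduct.map (αH ∘ₗ αH) (αM ∘ₗ αM)) ∘ₗ
          TensorProduct.map LinearMap.id lM := by
      ext h m
      simp [hαMco, TensorProduct.map_map]
    have ha : (TensorProduct.assoc k H H M).symm.toLinearMap ∘ₗ
        TensorProduct.map (αH ∘ₗ αH) (TensorProduct.map (αH ∘ₗ αH) (αM ∘ₗ αM))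
        = S ∘ₗ (TensorProduct.assoc k H H M).symm.toLinearMap := by
      ext a b m
      simp [S]
    calc _ = S ∘ₗ TensorProduct.map Δ LinearMap.id ∘ₗ lM := by
          rw [← LinearMap.comp_assoc, hl, LinearMap.comp_assoc]
      _ = S ∘ₗ (TensorProduct.assoc k H H M).symm.toLinearMap ∘ₗ
            TensorProduct.map LinearMap.id lM ∘ₗ lM := by rw [hcomod]
      _ = _ := by
          rw [← LinearMap.comp_assoc, ← ha, LinearMap.comp_assoc,
            ← LinearMap.comp_assoc lM, ← hr, LinearMap.comp_assoc]

theorem ydL_twist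
    (hαmul : ∀ a b : H, αH (μ (a ⊗ₜ[k] b)) = μ (αH a ⊗ₜ[k] αH b))
    (hαcomul : TensorProduct.map αH αH ∘ₗ Δ = Δ ∘ₗ αH) :
    ydL k (αH ∘ₗ μ) (Δ ∘ₗ αH) (αH ∘ₗ αH)
        (ρ ∘ₗ TensorProduct.map αH αM) (TensorProduct.map αH αM ∘ₗ lM)
      = TensorProduct.map (αH ∘ₗ αH) αM ∘ₗ ydL k μ Δ LinearMap.id ρ lM ∘ₗ
          TensorProduct.map (αH ∘ₗ αH) αM := by
  have hΔ (h : H) : Δ (αH h) = TensorProduct.map αH αH (Δ h) :=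
    (LinearMap.congr_fun hαcomul h).symm
  ext h m
  simp only [ydL, TensorProduct.AlgebraTensorModule.curry_apply, TensorProduct.curry_apply,
    LinearMap.coe_restrictScalars, LinearMap.comp_apply, TensorProduct.map_tmul,
    LinearMap.id_apply, hΔ]
  induction Δ h with
  | zero => simp
  | add x y hx hy => simp only [map_add, TensorProduct.add_tmul, hx, hy]
  | tmul a b =>
    simp only [TensorProduct.map_tmul, rearr_tmul, LinearMap.comp_apply, LinearMap.id_apply]
    induction lM (ρ (αH (αH a) ⊗ₜ[k] αM m)) with
    | zero => simp
    | add x y hx hy => simp only [map_add, TensorProduct.add_tmul, hx, hy]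
    | tmul c n => simp [hαmul]

theorem ydR_twist
    (hαmul : ∀ a b : H, αH (μ (a ⊗ₜ[k] b)) = μ (αH a ⊗ₜ[k] αH b))
    (hαcomul : TensorProduct.map αH αH ∘ₗ Δ = Δ ∘ₗ αH)
    (hαM : ∀ (h : H) (m : M), αM (ρ (h ⊗ₜ[k] m)) = ρ (αH h ⊗ₜ[k] αM m))
    (hαMco : ∀ m : M, lM (αM m) = TensorProduct.map αH αM (lM m)) :
    ydR k (αH ∘ₗ μ) (Δ ∘ₗ αH) (αH ∘ₗ αH) αH
        (ρ ∘ₗ TensorProduct.map αH αM) (TensorProduct.map αH αM ∘ₗ lM)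
      = TensorProduct.map (αH ∘ₗ αH) αM ∘ₗ
          ydR k μ Δ LinearMap.id LinearMap.id ρ lM ∘ₗ
          TensorProduct.map (αH ∘ₗ αH) αM := by
  have hΔ (h : H) : Δ (αH h) = TensorProduct.map αH αH (Δ h) :=
    (LinearMap.congr_fun hαcomul h).symm
  ext h m
  simp only [ydR, TensorProduct.AlgebraTensorModule.curry_apply, TensorProduct.curry_apply,
    LinearMap.coe_restrictScalars, LinearMap.comp_apply, TensorProduct.map_tmul, hΔ, hαMco]
  induction Δ h with
  | zero => simp
  | add x y hx hy => simp only [map_add, TensorProduct.add_tmul, hx, hy]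
  | tmul a b =>
    induction lM m with
    | zero => simp
    | add x y hx hy => simp only [map_add, TensorProduct.tmul_add, hx, hy]
    | tmul c n => simp [hαmul, hαM]

end Twist

/-- twisting a classical Yetter-Drinfeld module along a bialgebra
endomorphism yields a Yetter-Drinfeld module over the twisted Hom-bialgebra. -/
theorem stmt0 {k H M : Type*} [Field k]
    [AddCommGroup H] [Module k H] [AddCommGroup M] [Module k M]
    (μ : H ⊗[k] H →ₗ[k] H) (Δ : H →ₗ[k] H ⊗[k] H) (αH : H →ₗ[k] H)
    (ρ : H ⊗[k] M →ₗ[k] M) (lM : M →ₗ[k] H ⊗[k] M) (αM : M →ₗ[k] M)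
    -- (H, μ, Δ) is a (non-unital, non-counital) bialgebra
    (hassoc : ∀ a b c : H, μ (μ (a ⊗ₜ[k] b) ⊗ₜ[k] c) = μ (a ⊗ₜ[k] μ (b ⊗ₜ[k] c)))
    (hcoassoc : (TensorProduct.assoc k H H H).toLinearMap ∘ₗ
        TensorProduct.map Δ (LinearMap.id : H →ₗ[k] H) ∘ₗ Δ
        = TensorProduct.map (LinearMap.id : H →ₗ[k] H) Δ ∘ₗ Δ)
    (hΔmul : Δ ∘ₗ μ = TensorProduct.map μ μ ∘ₗ ttc k H H H H ∘ₗ TensorProduct.map Δ Δ)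
    -- αH is a bialgebra endomorphism
    (hαmul : ∀ a b : H, αH (μ (a ⊗ₜ[k] b)) = μ (αH a ⊗ₜ[k] αH b))
    (hαcomul : TensorProduct.map αH αH ∘ₗ Δ = Δ ∘ₗ αH)
    -- M is a classical left H-module and left H-comodule
    (hmod : ∀ (a b : H) (m : M), ρ (μ (a ⊗ₜ[k] b) ⊗ₜ[k] m) = ρ (a ⊗ₜ[k] ρ (b ⊗ₜ[k] m)))
    (hcomod : TensorProduct.map Δ (LinearMap.id : M →ₗ[k] M) ∘ₗ lM
        = (TensorProduct.assoc k H H M).symm.toLinearMap ∘ₗ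
            TensorProduct.map (LinearMap.id : H →ₗ[k] H) lM ∘ₗ lM)
    -- classical Yetter-Drinfeld compatibility:
    -- (h₁·m)₍₋₁₎h₂ ⊗ (h₁·m)₍₀₎ = h₁m₍₋₁₎ ⊗ h₂·m₍₀₎
    (hyd : ydL k μ Δ LinearMap.id ρ lM = ydR k μ Δ LinearMap.id LinearMap.id ρ lM)
    -- compatibility of αM with the action and the coaction
    (hαM : ∀ (h : H) (m : M), αM (ρ (h ⊗ₜ[k] m)) = ρ (αH h ⊗ₜ[k] αM m))
    (hαMco : ∀ m : M, lM (αM m) = TensorProduct.map αH αM (lM m)) :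
    IsYetterDrinfeld k (αH ∘ₗ μ) (Δ ∘ₗ αH) αH
      (ρ ∘ₗ TensorProduct.map αH αM) (TensorProduct.map αH αM ∘ₗ lM) αM := by
  refine ⟨.twist hαmul hmod hαM, .twist hαcomul hcomod hαMco, ?_⟩
  rw [ydL_twist hαmul hαcomul, ydR_twist hαmul hαcomul hαM hαMco, hyd]

end HomYD
end
end

section
/- Let (H, μ, Δ, α_H) be a Hom-bialgebra with α_H bijective, and let (M, α_M), (N, α_N), (P, α_P) be Yetter-Drinfeld modules over H. Define B_{X,Y}: X⊗Y → Y⊗X by B_{X,Y}(x⊗y) = α_H^{-1}(x_{(-1)})·y ⊗ x_{(0)} for each pair of these Yetter-Drinfeld modules. Then the maps B satisfy the Hom-Yang-Baxter equation: (α_P⊗B_{M,N})∘(B_{M,P}⊗α_N)∘(α_M⊗B_{N,P}) = (B_{N,P}⊗α_M)∘(α_N⊗B_{M,P})∘(B_{M,N}⊗α_P) as maps M⊗N⊗P → P⊗N⊗M. -/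
open TensorProduct

noncomputable section

namespace HomYD

variable (k : Type*) [Field k]
variable {H M N : Type*}
variable [AddCommGroup H] [Module k H]
variable [AddCommGroup M] [Module k M]
variable [AddCommGroup N] [Module k N]

section YangBaxter

variable {k : Type*} [Field k] {H M N P : Type*}
  [AddCommGroup H] [Module k H] [AddCommGroup M] [Module k M]
  [AddCommGroup N] [Module k N] [AddCommGroup P] [Module k P]

@[simp]
lemma rearr_tmul_s2 (a : M) (b : N) (c : P) :
    rearr k M N P ((a ⊗ₜ b) ⊗ₜ c) = (a ⊗ₜ c) ⊗ₜ b := rfl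

@[simp]
lemma ttc_tmul_s2 (a : H) (b : M) (c : N) (d : P) :
    ttc k H M N P ((a ⊗ₜ b) ⊗ₜ (c ⊗ₜ d)) = (a ⊗ₜ c) ⊗ₜ (b ⊗ₜ d) := rfl

/-- `a ⊗ b ↦ a n₍₋₁₎ ⊗ b·αN(n₍₀₎)`, where `y` stands for the coaction of `n`. -/
def twistR (μ : H ⊗[k] H →ₗ[k] H) (ρN : H ⊗[k] N →ₗ[k] N) (αN : N →ₗ[k] N)
    (y : H ⊗[k] N) : H ⊗[k] H →ₗ[k] H ⊗[k] N :=
  TensorProduct.map μ (ρN ∘ₗ TensorProduct.map LinearMap.id αN) ∘ₗ ttc k H H H N ∘ₗ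
    (TensorProduct.mk k (H ⊗[k] H) (H ⊗[k] N)).flip y

/-- `a ⊗ b ↦ β²((a·n)₍₋₁₎) β(b) ⊗ (a·n)₍₀₎`. -/
def twistL (μ : H ⊗[k] H →ₗ[k] H) (β : H →ₗ[k] H) (ρN : H ⊗[k] N →ₗ[k] N)
    (lN : N →ₗ[k] H ⊗[k] N) (n : N) : H ⊗[k] H →ₗ[k] H ⊗[k] N :=
  TensorProduct.map (μ ∘ₗ TensorProduct.map (β ∘ₗ β) β) LinearMap.id ∘ₗ rearr k H N H ∘ₗ
    TensorProduct.map (lN ∘ₗ ρN ∘ₗ (TensorProduct.mk k H N).flip n) LinearMap.id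

/-- `a ⊗ (b ⊗ m) ↦ h·p ⊗ (n ⊗ m)`, where `h ⊗ n` is the image of `a ⊗ b` under `K`. -/
def actTriple (ρP : H ⊗[k] P →ₗ[k] P) (p : P) (K : H ⊗[k] H →ₗ[k] H ⊗[k] N) :
    H ⊗[k] (H ⊗[k] M) →ₗ[k] P ⊗[k] (N ⊗[k] M) :=
  (TensorProduct.assoc k P N M).toLinearMap ∘ₗ
    TensorProduct.map
      (TensorProduct.map (ρP ∘ₗ (TensorProduct.mk k H P).flip p) LinearMap.id ∘ₗ K)
      LinearMap.id ∘ₗ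
      (TensorProduct.assoc k H H M).symm.toLinearMap

lemma IsHomBialgebra.symm_mul {μ : H ⊗[k] H →ₗ[k] H} {Δ : H →ₗ[k] H ⊗[k] H} {αH : H ≃ₗ[k] H}
    (hH : IsHomBialgebra k μ Δ αH.toLinearMap) (a b : H) :
    αH.symm (μ (a ⊗ₜ b)) = μ (αH.symm a ⊗ₜ αH.symm b) := by
  apply αH.injective
  simpa using (hH.mul_mult (αH.symm a) (αH.symm b)).symm

lemma IsHomBialgebra.comul_apply {μ : H ⊗[k] H →ₗ[k] H} {Δ : H →ₗ[k] H ⊗[k] H}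
    {α : H →ₗ[k] H} (hH : IsHomBialgebra k μ Δ α) (h : H) :
    Δ (α h) = TensorProduct.map α α (Δ h) :=
  (LinearMap.congr_fun hH.comul_compat h).symm

lemma IsHomComodule.coaction_apply {Δ : H →ₗ[k] H ⊗[k] H} {α : H →ₗ[k] H}
    {lM : M →ₗ[k] H ⊗[k] M} {αM : M →ₗ[k] M} (hM : IsHomComodule k Δ α lM αM) (m : M) :
    lM (αM m) = TensorProduct.map α αM (lM m) :=
  (LinearMap.congr_fun hM.str_compat m).symm

/-- Hom-coassociativity of a coaction, with `αH` inverted on the first leg. -/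
lemma IsHomComodule.coaction_coaction {Δ : H →ₗ[k] H ⊗[k] H} {αH : H ≃ₗ[k] H}
    {lM : M →ₗ[k] H ⊗[k] M} {αM : M →ₗ[k] M} (hM : IsHomComodule k Δ αH.toLinearMap lM αM)
    (m : M) :
    TensorProduct.map LinearMap.id (TensorProduct.map LinearMap.id αM ∘ₗ lM) (lM m) =
      TensorProduct.assoc k H H M
        (TensorProduct.map (TensorProduct.map αH.symm.toLinearMap LinearMap.id ∘ₗ Δ)
          (αM ∘ₗ αM) (lM m)) := by
  have h := congrArg (TensorProduct.map αH.symm.toLinearMap (TensorProduct.map LinearMap.id αM) ∘ₗ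
    (TensorProduct.assoc k H H M).toLinearMap) (LinearMap.congr_fun hM.hom_coact m)
  have hl : ∀ x : H ⊗[k] M, TensorProduct.map αH.symm.toLinearMap
      (TensorProduct.map LinearMap.id αM)
      (TensorProduct.map αH.toLinearMap lM x) =
      TensorProduct.map LinearMap.id (TensorProduct.map LinearMap.id αM ∘ₗ lM) x := by
    intro x
    induction x with
    | zero => simp
    | add x y hx hy => simp only [map_add, hx, hy]
    | tmul a m => simp
  have hr : ∀ x : H ⊗[k] M, TensorProduct.map αH.symm.toLinearMap
      (TensorProduct.map LinearMap.id αM)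
      (TensorProduct.assoc k H H M (TensorProduct.map Δ αM x)) =
      TensorProduct.assoc k H H M
        (TensorProduct.map (TensorProduct.map αH.symm.toLinearMap LinearMap.id ∘ₗ Δ)
          (αM ∘ₗ αM) x) := by
    intro x
    induction x with
    | zero => simp
    | add x y hx hy => simp only [map_add, hx, hy]
    | tmul a m =>
      simp only [TensorProduct.map_tmul, LinearMap.comp_apply]
      induction Δ a with
      | zero => simp
      | add x y hx hy => simp only [map_add, TensorProduct.add_tmul, hx, hy]
      | tmul a b => simp
  simpa [hl, hr] using h.symm

/-- The Yetter-Drinfeld compatibility, with the powers of `αH` inverted. -/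
lemma IsYetterDrinfeld.twistL_eq_twistR {μ : H ⊗[k] H →ₗ[k] H} {Δ : H →ₗ[k] H ⊗[k] H}
    {αH : H ≃ₗ[k] H} (hH : IsHomBialgebra k μ Δ αH.toLinearMap)
    {ρN : H ⊗[k] N →ₗ[k] N} {lN : N →ₗ[k] H ⊗[k] N} {αN : N →ₗ[k] N}
    (hN : IsYetterDrinfeld k μ Δ αH.toLinearMap ρN lN αN) (n : N) :
    twistL μ αH.symm.toLinearMap ρN lN (αN n) ∘ₗ
        TensorProduct.map αH.symm.toLinearMap LinearMap.id ∘ₗ Δ =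
      twistR μ ρN αN (lN n) ∘ₗ TensorProduct.map αH.symm.toLinearMap LinearMap.id ∘ₗ Δ := by
  ext h
  obtain ⟨h, rfl⟩ := αH.surjective h
  have hΔ : Δ (αH h) = TensorProduct.map αH.toLinearMap αH.toLinearMap (Δ h) :=
    hH.comul_apply h
  have key := congrArg
    (TensorProduct.map (αH.symm.toLinearMap ∘ₗ αH.symm.toLinearMap) (LinearMap.id : N →ₗ[k] N))
    (LinearMap.congr_fun hN.2.2 (h ⊗ₜ αN n))
  simp only [ydL, ydR, LinearMap.comp_apply, TensorProduct.map_tmul, LinearMap.id_apply,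
    hN.2.1.coaction_apply] at key
  simp only [LinearMap.comp_apply, hΔ]
  have hl : ∀ d : H ⊗[k] H, twistL μ αH.symm.toLinearMap ρN lN (αN n)
      (TensorProduct.map αH.symm.toLinearMap LinearMap.id
        (TensorProduct.map αH.toLinearMap αH.toLinearMap d)) =
      TensorProduct.map (αH.symm.toLinearMap ∘ₗ αH.symm.toLinearMap) LinearMap.id
        (TensorProduct.map μ LinearMap.id (rearr k H N H
          (TensorProduct.map (lN ∘ₗ ρN) (αH.toLinearMap ∘ₗ αH.toLinearMap)
            (rearr k H H N (d ⊗ₜ αN n))))) := by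
    intro d
    induction d with
    | zero => simp
    | add x y hx hy => simp only [map_add, TensorProduct.add_tmul, hx, hy]
    | tmul a b =>
      simp only [twistL, rearr_tmul_s2, TensorProduct.map_tmul, LinearMap.comp_apply,
        LinearEquiv.coe_coe, LinearEquiv.symm_apply_apply, LinearMap.id_apply,
        LinearMap.flip_apply, TensorProduct.mk_apply]
      induction lN (ρN (a ⊗ₜ αN n)) with
      | zero => simp
      | add x y hx hy => simp only [map_add, TensorProduct.add_tmul, hx, hy]
      | tmul c q => simp [hH.symm_mul]
  have hr : ∀ (d : H ⊗[k] H) (y : H ⊗[k] N), twistR μ ρN αN y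
      (TensorProduct.map αH.symm.toLinearMap LinearMap.id
        (TensorProduct.map αH.toLinearMap αH.toLinearMap d)) =
      TensorProduct.map (αH.symm.toLinearMap ∘ₗ αH.symm.toLinearMap) LinearMap.id
        (TensorProduct.map (μ ∘ₗ TensorProduct.map (αH.toLinearMap ∘ₗ αH.toLinearMap)
            αH.toLinearMap) (ρN ∘ₗ TensorProduct.map αH.toLinearMap LinearMap.id)
          (ttc k H H H N (d ⊗ₜ TensorProduct.map αH.toLinearMap αN y))) := by
    intro d y
    simp only [twistR, LinearMap.comp_apply, LinearMap.flip_apply, TensorProduct.mk_apply]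
    induction d with
    | zero => simp
    | add x y hx hy => simp only [map_add, TensorProduct.add_tmul, hx, hy]
    | tmul a b =>
      induction y with
      | zero => simp
      | add x y hx hy => simp only [map_add, TensorProduct.tmul_add, hx, hy]
      | tmul c q => simp [hH.symm_mul]
  rw [hl, hr]
  exact key

lemma actTriple_twistR (μ : H ⊗[k] H →ₗ[k] H) {αH : H ≃ₗ[k] H}
    {Δ : H →ₗ[k] H ⊗[k] H} (hH : IsHomBialgebra k μ Δ αH.toLinearMap)
    {lM : M →ₗ[k] H ⊗[k] M} {αM : M →ₗ[k] M} (hM : IsHomComodule k Δ αH.toLinearMap lM αM)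
    (ρN : H ⊗[k] N →ₗ[k] N) (lN : N →ₗ[k] H ⊗[k] N) (αN : N →ₗ[k] N)
    {ρP : H ⊗[k] P →ₗ[k] P} {αP : P →ₗ[k] P} (hP : IsHomModule k μ αH.toLinearMap ρP αP)
    (m : M) (n : N) (p : P) :
    TensorProduct.map αP (Bmap k αH.symm.toLinearMap lM ρN)
        (TensorProduct.assoc k P M N
          (TensorProduct.map (Bmap k αH.symm.toLinearMap lM ρP) αN
            ((TensorProduct.assoc k M P N).symm
              (αM m ⊗ₜ Bmap k αH.symm.toLinearMap lN ρP (n ⊗ₜ p))))) =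
      actTriple ρP (αP (αP p)) (twistR μ ρN αN (lN n))
        (TensorProduct.map LinearMap.id (TensorProduct.map LinearMap.id αM ∘ₗ lM) (lM m)) := by
  have hs : ∀ (a b : H) (p : P), ρP (a ⊗ₜ ρP (b ⊗ₜ p)) =
      ρP (μ (αH.symm a ⊗ₜ b) ⊗ₜ αP p) := fun a b p => by
    simpa using hP.hom_smul (αH.symm a) b p
  have hα : ∀ (a : H) (p : P), αP (ρP (a ⊗ₜ p)) = ρP (αH a ⊗ₜ αP p) := hP.str_compat
  have hμ : ∀ a b : H, αH (μ (a ⊗ₜ b)) = μ (αH a ⊗ₜ αH b) := hH.mul_mult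
  simp only [Bmap, actTriple, twistR, LinearMap.comp_apply, TensorProduct.map_tmul,
    LinearMap.id_apply]
  induction lN n with
  | zero => simp
  | add x y hx hy =>
    simp only [TensorProduct.add_tmul, TensorProduct.tmul_add, map_add, hx, hy,
      TensorProduct.map_add_left, LinearMap.comp_add, LinearMap.add_apply]
  | tmul b q =>
    simp only [rearr_tmul_s2, TensorProduct.map_tmul, TensorProduct.assoc_symm_tmul,
      LinearMap.comp_apply, LinearMap.id_apply, hM.coaction_apply]
    induction lM m with
    | zero => simp
    | add x y hx hy => simp only [TensorProduct.add_tmul, map_add, hx, hy]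
    | tmul a r =>
      simp only [rearr_tmul_s2, TensorProduct.map_tmul, TensorProduct.assoc_tmul,
        LinearMap.comp_apply, LinearMap.id_apply, hM.coaction_apply]
      induction lM r with
      | zero => simp
      | add x y hx hy => simp only [TensorProduct.add_tmul, TensorProduct.tmul_add, map_add, hx, hy]
      | tmul c s => simp [hs, hα, hμ]

lemma actTriple_twistL (μ : H ⊗[k] H →ₗ[k] H) {αH : H ≃ₗ[k] H}
    (lM : M →ₗ[k] H ⊗[k] M) (αM : M →ₗ[k] M)
    {ρN : H ⊗[k] N →ₗ[k] N} (lN : N →ₗ[k] H ⊗[k] N) {αN : N →ₗ[k] N}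
    (hN : IsHomModule k μ αH.toLinearMap ρN αN)
    {ρP : H ⊗[k] P →ₗ[k] P} {αP : P →ₗ[k] P} (hP : IsHomModule k μ αH.toLinearMap ρP αP)
    (m : M) (n : N) (p : P) :
    TensorProduct.assoc k P N M
        (TensorProduct.map (Bmap k αH.symm.toLinearMap lN ρP) αM
          ((TensorProduct.assoc k N P M).symm
            (TensorProduct.map αN (Bmap k αH.symm.toLinearMap lM ρP)
              (TensorProduct.assoc k N M P
                (Bmap k αH.symm.toLinearMap lM ρN (m ⊗ₜ n) ⊗ₜ αP p))))) =
      actTriple ρP (αP (αP p)) (twistL μ αH.symm.toLinearMap ρN lN (αN n))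
        (TensorProduct.map LinearMap.id (TensorProduct.map LinearMap.id αM ∘ₗ lM) (lM m)) := by
  have hs : ∀ (a b : H) (p : P), ρP (a ⊗ₜ ρP (b ⊗ₜ p)) =
      ρP (μ (αH.symm a ⊗ₜ b) ⊗ₜ αP p) := fun a b p => by
    simpa using hP.hom_smul (αH.symm a) b p
  have hα : ∀ (a : H) (n : N), αN (ρN (a ⊗ₜ n)) = ρN (αH a ⊗ₜ αN n) := hN.str_compat
  simp only [Bmap, actTriple, twistL, LinearMap.comp_apply, TensorProduct.map_tmul,
    LinearMap.id_apply]
  induction lM m with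
  | zero => simp
  | add x y hx hy => simp only [TensorProduct.add_tmul, map_add, hx, hy]
  | tmul a r =>
    simp only [rearr_tmul_s2, TensorProduct.map_tmul, TensorProduct.assoc_tmul,
      LinearMap.comp_apply, LinearMap.id_apply, LinearEquiv.coe_coe, hα,
      LinearEquiv.apply_symm_apply]
    induction lM r with
    | zero => simp
    | add x y hx hy => simp only [TensorProduct.add_tmul, TensorProduct.tmul_add, map_add, hx, hy]
    | tmul b s =>
      simp only [rearr_tmul_s2, TensorProduct.map_tmul, TensorProduct.assoc_symm_tmul,
        LinearMap.comp_apply, LinearMap.id_apply, LinearEquiv.coe_coe,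
        LinearMap.flip_apply, TensorProduct.mk_apply]
      induction lN (ρN (a ⊗ₜ αN n)) with
      | zero => simp
      | add x y hx hy => simp only [TensorProduct.add_tmul, map_add, hx, hy]
      | tmul c q => simp [hs]

lemma actTriple_assoc_map (ρP : H ⊗[k] P →ₗ[k] P) (p : P) (K : H ⊗[k] H →ₗ[k] H ⊗[k] N)
    (δ : H →ₗ[k] H ⊗[k] H) (γ : M →ₗ[k] M) (x : H ⊗[k] M) :
    actTriple ρP p K (TensorProduct.assoc k H H M (TensorProduct.map δ γ x)) =
      TensorProduct.assoc k P N M (TensorProduct.map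
        (TensorProduct.map (ρP ∘ₗ (TensorProduct.mk k H P).flip p) LinearMap.id ∘ₗ K ∘ₗ δ)
        γ x) := by
  induction x with
  | zero => simp
  | add x y hx hy => simp only [map_add, hx, hy]
  | tmul a m => simp [actTriple]

end YangBaxter

/-- the maps `B_{X,Y}(x ⊗ y) = αH⁻¹(x₍₋₁₎)·y ⊗ x₍₀₎` on Yetter-Drinfeld
modules satisfy the Hom-Yang-Baxter equation. -/
theorem stmt2 {k H M N P : Type*} [Field k]
    [AddCommGroup H] [Module k H] [AddCommGroup M] [Module k M]
    [AddCommGroup N] [Module k N] [AddCommGroup P] [Module k P]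
    (μ : H ⊗[k] H →ₗ[k] H) (Δ : H →ₗ[k] H ⊗[k] H) (αH : H ≃ₗ[k] H)
    (hH : IsHomBialgebra k μ Δ αH.toLinearMap)
    (ρM : H ⊗[k] M →ₗ[k] M) (lM : M →ₗ[k] H ⊗[k] M) (αM : M →ₗ[k] M)
    (hM : IsYetterDrinfeld k μ Δ αH.toLinearMap ρM lM αM)
    (ρN : H ⊗[k] N →ₗ[k] N) (lN : N →ₗ[k] H ⊗[k] N) (αN : N →ₗ[k] N)
    (hN : IsYetterDrinfeld k μ Δ αH.toLinearMap ρN lN αN)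
    (ρP : H ⊗[k] P →ₗ[k] P) (lP : P →ₗ[k] H ⊗[k] P) (αP : P →ₗ[k] P)
    (hP : IsYetterDrinfeld k μ Δ αH.toLinearMap ρP lP αP) :
    TensorProduct.map αP (Bmap k αH.symm.toLinearMap lM ρN) ∘ₗ
        (TensorProduct.assoc k P M N).toLinearMap ∘ₗ
          TensorProduct.map (Bmap k αH.symm.toLinearMap lM ρP) αN ∘ₗ
            (TensorProduct.assoc k M P N).symm.toLinearMap ∘ₗ
              TensorProduct.map αM (Bmap k αH.symm.toLinearMap lN ρP)
      = (TensorProduct.assoc k P N M).toLinearMap ∘ₗ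
          TensorProduct.map (Bmap k αH.symm.toLinearMap lN ρP) αM ∘ₗ
            (TensorProduct.assoc k N P M).symm.toLinearMap ∘ₗ
              TensorProduct.map αN (Bmap k αH.symm.toLinearMap lM ρP) ∘ₗ
                (TensorProduct.assoc k N M P).toLinearMap ∘ₗ
                  TensorProduct.map (Bmap k αH.symm.toLinearMap lM ρN) αP ∘ₗ
                    (TensorProduct.assoc k M N P).symm.toLinearMap := by
  refine TensorProduct.ext (LinearMap.ext fun m => TensorProduct.ext' fun n p => ?_)
  refine (actTriple_twistR μ hH hM.2.1 ρN lN αN hP.1 m n p).trans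
    (Eq.trans ?_ (actTriple_twistL μ lM αM lN hN.1 hP.1 m n p).symm)
  rw [hM.2.1.coaction_coaction, actTriple_assoc_map, actTriple_assoc_map,
    hN.twistL_eq_twistR hH]

end HomYD
end
end
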